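/- Let E be a geodesic metric space without bifurcating geodesics, let A be a nonempty bounded subset of E, and suppose a₁∈A and x₁∈E satisfy d(x₁,a₁) ≥ d(x₁,a) for all a∈A. Let x'∈E be a point such that x₁ lies on a geodesic segment joining a₁ and x' with d(x₁,x') > 0 (so that d(a₁,x') = d(a₁,x₁) + d(x₁,x')). Then d(x',a₁) = Dist(x',A) and a₁ is the unique farthest point of A from x': for every a∈A with d(x',a) = Dist(x',A) one has a = a₁. -/

import Mathlib

open Metric Set Filter Bornology

noncomputable section

/-- A geodesic path of length `l`: a map `c : ℝ → E` that is isometric on `[0, l]`. -/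
def IsGeodesicPath {E : Type*} [MetricSpace E] (c : ℝ → E) (l : ℝ) : Prop :=
  0 ≤ l ∧ ∀ s ∈ Icc (0:ℝ) l, ∀ t ∈ Icc (0:ℝ) l, dist (c s) (c t) = |s - t|

/-- `S` is a geodesic segment joining `x` and `y`. -/
def IsGeodesicSegment {E : Type*} [MetricSpace E] (S : Set E) (x y : E) : Prop :=
  ∃ c l, IsGeodesicPath c l ∧ c 0 = x ∧ c l = y ∧ S = c '' Icc (0:ℝ) l

/-- A geodesic (line): an isometric image of `ℝ`. -/
def IsGeodesicLine {E : Type*} [MetricSpace E] (S : Set E) : Prop :=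
  ∃ c : ℝ → E, Isometry c ∧ S = Set.range c

/-- `E` is a geodesic space: every two points are joined by a geodesic path. -/
def IsGeodesicSpace (E : Type*) [MetricSpace E] : Prop :=
  ∀ x y : E, ∃ S, IsGeodesicSegment S x y

/-- `E` has the geodesic extension property: every geodesic segment is contained
in a geodesic. -/
def GeodesicExtensionProperty (E : Type*) [MetricSpace E] : Prop :=
  ∀ (S : Set E) (x y : E), IsGeodesicSegment S x y → ∃ L, IsGeodesicLine L ∧ S ⊆ L

/-- The metric of `E` is convex. -/
def HasConvexMetric (E : Type*) [MetricSpace E] : Prop :=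
  ∀ (c₁ c₂ : ℝ → E) (l₁ l₂ : ℝ), IsGeodesicPath c₁ l₁ → IsGeodesicPath c₂ l₂ →
    ∀ t ∈ Icc (0:ℝ) 1,
      dist (c₁ (t * l₁)) (c₂ (t * l₂)) ≤
        (1 - t) * dist (c₁ 0) (c₂ 0) + t * dist (c₁ l₁) (c₂ l₂)

/-- A subset `X` is (geodesically) convex: any geodesic segment joining two points
of `X` is contained in `X`. -/
def GeodesicConvex {E : Type*} [MetricSpace E] (X : Set E) : Prop :=
  ∀ x ∈ X, ∀ y ∈ X, ∀ S : Set E, IsGeodesicSegment S x y → S ⊆ X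

/-- A function `f : E → ℝ` is (geodesically) convex. -/
def GeodesicConvexFun {E : Type*} [MetricSpace E] (f : E → ℝ) : Prop :=
  ∀ (c : ℝ → E) (l : ℝ), IsGeodesicPath c l → ∀ t ∈ Icc (0:ℝ) 1,
    f (c (t * l)) ≤ (1 - t) * f (c 0) + t * f (c l)

/-- `G₁(S)`: the union of all geodesic segments with endpoints in `S`. -/
def geodSegUnion {E : Type*} [MetricSpace E] (S : Set E) : Set E :=
  {z | ∃ x ∈ S, ∃ y ∈ S, ∃ T : Set E, IsGeodesicSegment T x y ∧ z ∈ T}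

/-- The iterates `G_n(S)`. -/
def geodGn {E : Type*} [MetricSpace E] (S : Set E) : ℕ → Set E
  | 0 => S
  | n + 1 => geodSegUnion (geodGn S n)

/-- The (geodesic) convex hull `co(S) = ⋃ₙ G_n(S)`. -/
def geodConvexHull {E : Type*} [MetricSpace E] (S : Set E) : Set E :=
  ⋃ n, geodGn S n

/-- `E` is without bifurcating geodesics. -/
def NoBifurcatingGeodesics (E : Type*) [MetricSpace E] : Prop :=
  ∀ (p a b : E) (S₁ S₂ : Set E), IsGeodesicSegment S₁ p a → IsGeodesicSegment S₂ p b →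
    ∀ z, z ∈ S₁ → z ∈ S₂ → z ≠ p → (z = a ∧ z = b) ∨ S₁ ⊆ S₂ ∨ S₂ ⊆ S₁

/-- `E` is reflexive: every descending sequence of nonempty, bounded, closed and convex
subsets of `E` has nonempty intersection. -/
def ReflexiveGeodesicSpace (E : Type*) [MetricSpace E] : Prop :=
  ∀ C : ℕ → Set E, (∀ n, (C n).Nonempty) → (∀ n, IsBounded (C n)) → (∀ n, IsClosed (C n)) →
    (∀ n, GeodesicConvex (C n)) → (∀ n, C (n + 1) ⊆ C n) → (⋂ n, C n).Nonempty

/-- `Dist(x, A)`: the remotal (farthest) distance from `x` to `A`. -/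
def supDist {E : Type*} [MetricSpace E] (x : E) (A : Set E) : ℝ :=
  sSup ((fun a => dist x a) '' A)

/-- `λ_{XY} = inf{ d(x,y) : x ∈ X, y ∈ Y }`. -/
def infSetDist {E : Type*} [MetricSpace E] (X Y : Set E) : ℝ :=
  sInf (Set.image2 dist X Y)

/-- `μ_{XY} = sup{ d(x,y) : x ∈ X, y ∈ Y }`. -/
def supSetDist {E : Type*} [MetricSpace E] (X Y : Set E) : ℝ :=
  sSup (Set.image2 dist X Y)

/-- `L_{XY}(σ) = { x ∈ X : dist(x,Y) ≤ λ_{XY} + σ }`. -/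
def Lset {E : Type*} [MetricSpace E] (X Y : Set E) (σ : ℝ) : Set E :=
  {x ∈ X | infDist x Y ≤ infSetDist X Y + σ}

/-- `M_{XY}(σ) = { x ∈ X : Dist(x,Y) ≥ μ_{XY} − σ }`. -/
def Mset {E : Type*} [MetricSpace E] (X Y : Set E) (σ : ℝ) : Set E :=
  {x ∈ X | supSetDist X Y - σ ≤ supDist x Y}

/-- The minimization problem `min(X,Y)` is well-posed. -/
def MinWellPosed {E : Type*} [MetricSpace E] (X Y : Set E) : Prop :=
  ∃ x₀ ∈ X, ∃ y₀ ∈ Y, dist x₀ y₀ = infSetDist X Y ∧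
    (∀ x ∈ X, ∀ y ∈ Y, dist x y = infSetDist X Y → x = x₀ ∧ y = y₀) ∧
    ∀ x : ℕ → E, ∀ y : ℕ → E, (∀ n, x n ∈ X) → (∀ n, y n ∈ Y) →
      Tendsto (fun n => dist (x n) (y n)) atTop (nhds (infSetDist X Y)) →
      Tendsto x atTop (nhds x₀) ∧ Tendsto y atTop (nhds y₀)

/-- The maximization problem `max(X,Y)` is well-posed. -/
def MaxWellPosed {E : Type*} [MetricSpace E] (X Y : Set E) : Prop :=
  ∃ x₀ ∈ X, ∃ y₀ ∈ Y, dist x₀ y₀ = supSetDist X Y ∧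
    (∀ x ∈ X, ∀ y ∈ Y, dist x y = supSetDist X Y → x = x₀ ∧ y = y₀) ∧
    ∀ x : ℕ → E, ∀ y : ℕ → E, (∀ n, x n ∈ X) → (∀ n, y n ∈ Y) →
      Tendsto (fun n => dist (x n) (y n)) atTop (nhds (supSetDist X Y)) →
      Tendsto x atTop (nhds x₀) ∧ Tendsto y atTop (nhds y₀)

/-- The distance of the model space `M²_κ` (κ < 0): the hyperbolic distance
multiplied by `1/√(-κ)`. -/
def kdist (κ : ℝ) (a b : UpperHalfPlane) : ℝ :=
  (Real.sqrt (-κ))⁻¹ * dist a b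

/-- `pb` is the comparison point in `M²_κ` (relative to the side from `xi` to `xj`,
with comparison vertices `xib`, `xjb`) of a point `p` on a geodesic segment from
`xi` to `xj`. -/
def IsComparisonPoint {E : Type*} [MetricSpace E] (κ : ℝ) (xi xj : E)
    (xib xjb : UpperHalfPlane) (p : E) (pb : UpperHalfPlane) : Prop :=
  kdist κ xib pb = dist xi p ∧ kdist κ pb xjb = dist p xj

/-- `E` has curvature bounded below by `κ < 0`: every geodesic triangle satisfies the
reversed CAT(κ) inequality with respect to any κ-comparison triangle in `M²_κ`. -/
def CurvBoundedBelow (E : Type*) [MetricSpace E] (κ : ℝ) : Prop :=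
  ∀ (x₁ x₂ x₃ : E) (S₁₂ S₂₃ S₁₃ : Set E),
    IsGeodesicSegment S₁₂ x₁ x₂ → IsGeodesicSegment S₂₃ x₂ x₃ → IsGeodesicSegment S₁₃ x₁ x₃ →
    ∀ x₁b x₂b x₃b : UpperHalfPlane,
      kdist κ x₁b x₂b = dist x₁ x₂ → kdist κ x₂b x₃b = dist x₂ x₃ →
      kdist κ x₁b x₃b = dist x₁ x₃ →
      ∀ (p q : E) (pb qb : UpperHalfPlane),
        ((p ∈ S₁₂ ∧ IsComparisonPoint κ x₁ x₂ x₁b x₂b p pb) ∨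
         (p ∈ S₂₃ ∧ IsComparisonPoint κ x₂ x₃ x₂b x₃b p pb) ∨
         (p ∈ S₁₃ ∧ IsComparisonPoint κ x₁ x₃ x₁b x₃b p pb)) →
        ((q ∈ S₁₂ ∧ IsComparisonPoint κ x₁ x₂ x₁b x₂b q qb) ∨
         (q ∈ S₂₃ ∧ IsComparisonPoint κ x₂ x₃ x₂b x₃b q qb) ∨
         (q ∈ S₁₃ ∧ IsComparisonPoint κ x₁ x₃ x₁b x₃b q qb)) →
        kdist κ pb qb ≤ dist p q

/-- Comparison points for Euclidean (κ = 0) comparison triangles in `ℝ²`. -/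
def IsComparisonPointE {E : Type*} [MetricSpace E] (xi xj : E)
    (xib xjb : EuclideanSpace ℝ (Fin 2)) (p : E) (pb : EuclideanSpace ℝ (Fin 2)) : Prop :=
  dist xib pb = dist xi p ∧ dist pb xjb = dist p xj

/-- `E` is a CAT(0) space: a geodesic space where every geodesic triangle satisfies the
CAT(0) comparison inequality with respect to Euclidean comparison triangles. -/
def CATZero (E : Type*) [MetricSpace E] : Prop :=
  IsGeodesicSpace E ∧
  ∀ (x₁ x₂ x₃ : E) (S₁₂ S₂₃ S₁₃ : Set E),
    IsGeodesicSegment S₁₂ x₁ x₂ → IsGeodesicSegment S₂₃ x₂ x₃ → IsGeodesicSegment S₁₃ x₁ x₃ →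
    ∀ x₁b x₂b x₃b : EuclideanSpace ℝ (Fin 2),
      dist x₁b x₂b = dist x₁ x₂ → dist x₂b x₃b = dist x₂ x₃ → dist x₁b x₃b = dist x₁ x₃ →
      ∀ (p q : E) (pb qb : EuclideanSpace ℝ (Fin 2)),
        ((p ∈ S₁₂ ∧ IsComparisonPointE x₁ x₂ x₁b x₂b p pb) ∨
         (p ∈ S₂₃ ∧ IsComparisonPointE x₂ x₃ x₂b x₃b p pb) ∨
         (p ∈ S₁₃ ∧ IsComparisonPointE x₁ x₃ x₁b x₃b p pb)) →
        ((q ∈ S₁₂ ∧ IsComparisonPointE x₁ x₂ x₁b x₂b q qb) ∨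
         (q ∈ S₂₃ ∧ IsComparisonPointE x₂ x₃ x₂b x₃b q qb) ∨
         (q ∈ S₁₃ ∧ IsComparisonPointE x₁ x₃ x₁b x₃b q qb)) →
        dist p q ≤ dist pb qb

/-- The space `P_{b,cl,cv}(E)` of nonempty, bounded, closed and convex subsets of `E`. -/
def Pbclcv (E : Type*) [MetricSpace E] : Type _ :=
  {X : Set E // X.Nonempty ∧ IsBounded X ∧ IsClosed X ∧ GeodesicConvex X}

/-- `P_{b,cl,cv}(E)` carries the Pompeiu-Hausdorff distance. -/
instance Pbclcv.metricSpace (E : Type*) [MetricSpace E] : MetricSpace (Pbclcv E) where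
  dist X Y := hausdorffDist X.1 Y.1
  dist_self X := hausdorffDist_self_zero
  dist_comm X Y := hausdorffDist_comm
  dist_triangle X Y Z := hausdorffDist_triangle
    (hausdorffEdist_ne_top_of_nonempty_of_bounded X.2.1 Y.2.1 X.2.2.1 Y.2.2.1)
  eq_of_dist_eq_zero := by
    intro X Y h
    exact Subtype.ext ((X.2.2.2.1.hausdorffDist_zero_iff_eq Y.2.2.2.1
      (hausdorffEdist_ne_top_of_nonempty_of_bounded X.2.1 Y.2.1 X.2.2.1 Y.2.2.1)).mp h)

/-- `P^A_{b,cl,cv}(E)`: the closure in `(P_{b,cl,cv}(E), h)` of the family of sets at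
positive distance from `A`. -/
def PAbclcv {E : Type*} [MetricSpace E] (A : Set E) : Set (Pbclcv E) :=
  closure {X : Pbclcv E | 0 < infSetDist X.1 A}

/-- The inverse hyperbolic cosine. -/
def arcosh (x : ℝ) : ℝ := Real.log (x + Real.sqrt (x ^ 2 - 1))

/-- The function `F_κ`. -/
def Fkappa (κ d r σ : ℝ) : ℝ :=
  2 / Real.sqrt (-κ) *
    arcosh (Real.cosh (Real.sqrt (-κ) * (r - d + σ)) ^ 2 -
      Real.sinh (Real.sqrt (-κ) * (r - d + σ)) / Real.sinh (Real.sqrt (-κ) * d) *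
        (Real.cosh (Real.sqrt (-κ) * r) -
          Real.cosh (Real.sqrt (-κ) * d) * Real.cosh (Real.sqrt (-κ) * (r - d + σ))))

/-- The petal `P_{α,δ}(x₀, f)`. -/
def petal {E : Type*} [MetricSpace E] (f : E → ℝ) (α δ : ℝ) (x₀ : E) : Set E :=
  {x | f x ≤ f x₀ - α * dist x x₀ + δ}

/-- `L_{A,f}(σ)`. -/
def LsetFun {E : Type*} [MetricSpace E] (A : Set E) (f : E → ℝ) (σ : ℝ) : Set E :=
  {x | f x ≤ sInf (f '' A) + σ ∧ infDist x A ≤ σ}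

/-- The problem `min(A,f)` is well-posed in the sense of Revalski. -/
def RevalskiWellPosed {E : Type*} [MetricSpace E] (A : Set E) (f : E → ℝ) : Prop :=
  sInf ((fun σ => diam (LsetFun A f σ)) '' Ioi 0) = 0

/-- The nearest point problem `min(X,y)` is well-posed. -/
def PointMinWellPosed {E : Type*} [MetricSpace E] (X : Set E) (y : E) : Prop :=
  ∃ x₀ ∈ X, dist x₀ y = infDist y X ∧ (∀ x ∈ X, dist x y = infDist y X → x = x₀) ∧
    ∀ x : ℕ → E, (∀ n, x n ∈ X) →
      Tendsto (fun n => dist (x n) y) atTop (nhds (infDist y X)) →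
      Tendsto x atTop (nhds x₀)

end

namespace IsGeodesicSegment

variable {E : Type*} [MetricSpace E] {S : Set E} {p q y : E}

theorem symm (hS : IsGeodesicSegment S p q) : IsGeodesicSegment S q p := by
  obtain ⟨c, l, ⟨hl, hc⟩, rfl, rfl, rfl⟩ := hS
  refine ⟨fun t => c (l - t), l, ⟨hl, fun s hs t ht => ?_⟩, by simp, by simp, ?_⟩
  · rw [hc _ ⟨by linarith [hs.2], by linarith [hs.1]⟩ _ ⟨by linarith [ht.2], by linarith [ht.1]⟩,
      abs_sub_comm]
    congr 1
    ring
  · ext z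
    constructor
    · rintro ⟨t, ht, rfl⟩
      exact ⟨l - t, ⟨by linarith [ht.2], by linarith [ht.1]⟩, by simp⟩
    · rintro ⟨t, ht, rfl⟩
      exact ⟨l - t, ⟨by linarith [ht.2], by linarith [ht.1]⟩, rfl⟩

theorem right_mem (hS : IsGeodesicSegment S p q) : q ∈ S := by
  obtain ⟨c, l, ⟨hl, -⟩, rfl, rfl, rfl⟩ := hS
  exact ⟨l, ⟨hl, le_rfl⟩, rfl⟩

theorem dist_add_dist (hS : IsGeodesicSegment S p q) (hy : y ∈ S) :
    dist p y + dist y q = dist p q := by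
  obtain ⟨c, l, ⟨hl, hc⟩, rfl, rfl, rfl⟩ := hS
  obtain ⟨t, ht, rfl⟩ := hy
  have h0 : (0 : ℝ) ∈ Icc 0 l := ⟨le_rfl, hl⟩
  have h1 : l ∈ Icc 0 l := ⟨hl, le_rfl⟩
  rw [hc 0 h0 t ht, hc t ht l h1, hc 0 h0 l h1, abs_of_nonpos (by linarith [ht.1]),
    abs_of_nonpos (by linarith [ht.2]), abs_of_nonpos (by linarith)]
  ring

theorem eq_right_of_dist_eq (hS : IsGeodesicSegment S p q) (hy : y ∈ S)
    (h : dist p y = dist p q) : y = q :=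
  dist_eq_zero.mp (by linarith [hS.dist_add_dist hy])

end IsGeodesicSegment

/-- Geodesics `p → q` and `q → r` concatenate to a geodesic when `q` is metrically between
`p` and `r`. -/
theorem IsGeodesicSpace.exists_segment_through {E : Type*} [MetricSpace E]
    (hgeo : IsGeodesicSpace E) {p q r : E} (h : dist p q + dist q r = dist p r) :
    ∃ S, IsGeodesicSegment S p r ∧ q ∈ S := by
  obtain ⟨_, c, l, ⟨hl, hc⟩, rfl, rfl, -⟩ := hgeo p q
  obtain ⟨_, g, m, ⟨hm, hg⟩, hg0, rfl, -⟩ := hgeo (c l) r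
  have hl0 : dist (c 0) (c l) = l := by
    rw [hc 0 ⟨le_rfl, hl⟩ l ⟨hl, le_rfl⟩, zero_sub, abs_neg, abs_of_nonneg hl]
  have hm0 : dist (c l) (g m) = m := by
    rw [← hg0, hg 0 ⟨le_rfl, hm⟩ m ⟨hm, le_rfl⟩, zero_sub, abs_neg, abs_of_nonneg hm]
  set f : ℝ → E := fun t => if t ≤ l then c t else g (t - l)
  have f_left : ∀ t, t ≤ l → f t = c t := fun t ht => if_pos ht
  have f_right : ∀ t, l ≤ t → f t = g (t - l) := by
    intro t ht
    rcases ht.eq_or_lt with rfl | ht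
    · rw [f_left _ le_rfl, sub_self, hg0]
    · exact if_neg ht.not_ge
  have key : ∀ s ∈ Icc (0 : ℝ) (l + m), ∀ t ∈ Icc (0 : ℝ) (l + m), s ≤ t →
      dist (f s) (f t) = t - s := by
    intro s hs t ht hst
    rcases le_total t l with htl | htl
    · rw [f_left s (hst.trans htl), f_left t htl, hc s ⟨hs.1, hst.trans htl⟩ t ⟨ht.1, htl⟩,
        abs_sub_comm, abs_of_nonneg (by linarith)]
    have ht' : t - l ∈ Icc 0 m := ⟨by linarith, by linarith [ht.2]⟩
    rcases le_total l s with hls | hsl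
    · rw [f_right s hls, f_right t htl,
        hg _ ⟨by linarith, by linarith [hs.2]⟩ _ ht', abs_sub_comm, abs_of_nonneg (by linarith)]
      ring
    · have hs' : s ∈ Icc 0 l := ⟨hs.1, hsl⟩
      rw [f_left s hsl, f_right t htl]
      have h1 : dist (c 0) (c s) = s := by
        rw [hc 0 ⟨le_rfl, hl⟩ s hs', zero_sub, abs_neg, abs_of_nonneg hs.1]
      have h2 : dist (c s) (c l) = l - s := by
        rw [hc s hs' l ⟨hl, le_rfl⟩, abs_sub_comm, abs_of_nonneg (by linarith)]
      have h3 : dist (c l) (g (t - l)) = t - l := by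
        rw [← hg0, hg 0 ⟨le_rfl, hm⟩ _ ht', zero_sub, abs_neg, abs_of_nonneg ht'.1]
      have h4 : dist (g (t - l)) (g m) = m - (t - l) := by
        rw [hg _ ht' m ⟨hm, le_rfl⟩, abs_sub_comm, abs_of_nonneg (by linarith [ht.2])]
      have upper := dist_triangle (c s) (c l) (g (t - l))
      have lower := dist_triangle4 (c 0) (c s) (g (t - l)) (g m)
      linarith
  refine ⟨f '' Icc 0 (l + m), ⟨f, l + m, ⟨by linarith, fun s hs t ht => ?_⟩, f_left 0 hl, ?_, rfl⟩,
    ⟨l, ⟨hl, by linarith⟩, f_left l le_rfl⟩⟩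
  · rcases le_total s t with hst | hst
    · rw [key s hs t ht hst, abs_sub_comm, abs_of_nonneg (by linarith)]
    · rw [dist_comm, key t ht s hs hst, abs_of_nonneg (by linarith)]
  · rw [f_right _ (by linarith), add_sub_cancel_left]

/-- unique farthest point along an extended geodesic in a space
without bifurcating geodesics. -/
theorem statement19 {E : Type*} [MetricSpace E] (hgeo : IsGeodesicSpace E)
    (hbif : NoBifurcatingGeodesics E)
    (A : Set E) (hA : A.Nonempty) (hAb : IsBounded A)
    (a₁ : E) (ha₁ : a₁ ∈ A) (x₁ x' : E)
    (hmax : ∀ a ∈ A, dist x₁ a ≤ dist x₁ a₁)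
    (S : Set E) (hS : IsGeodesicSegment S a₁ x') (hx₁ : x₁ ∈ S) (h : 0 < dist x₁ x') :
    dist x' a₁ = supDist x' A ∧ ∀ a ∈ A, dist x' a = supDist x' A → a = a₁ := by
  have hS' := hS.symm
  have hadd : dist x' x₁ + dist x₁ a₁ = dist x' a₁ := hS'.dist_add_dist hx₁
  have hle : ∀ a ∈ A, dist x' a ≤ dist x' a₁ := fun a ha => by
    linarith [dist_triangle x' x₁ a, hmax a ha]
  have hsup : dist x' a₁ = supDist x' A := by
    refine (IsGreatest.csSup_eq (s := (fun a => dist x' a) '' A) ⟨⟨a₁, ha₁, rfl⟩, ?_⟩).symm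
    rintro _ ⟨a, ha, rfl⟩
    exact hle a ha
  refine ⟨hsup, fun a ha hda => ?_⟩
  rw [← hsup] at hda
  have hbetween : dist x' x₁ + dist x₁ a = dist x' a := by
    linarith [dist_triangle x' x₁ a, hmax a ha]
  obtain ⟨T, hT, hxT⟩ := hgeo.exists_segment_through hbetween
  rcases hbif x' a₁ a S T hS' hT x₁ hx₁ hxT (dist_pos.mp h) with ⟨h1, h2⟩ | hST | hTS
  · exact h2.symm.trans h1
  · exact (hT.eq_right_of_dist_eq (hST hS'.right_mem) hda.symm).symm
  · exact hS'.eq_right_of_dist_eq (hTS hT.right_mem) hda
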